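/- Let β ∈ (β_T, 2], where β_T is the unique root of x³ − x² − 2x + 1 = 0 in (1,2). Then there exists x ∈ (0, 1/(β−1)) which has exactly one β-expansion, and this unique β-expansion is not simply normal. -/

import Mathlib

/-- `ε` (indexed from 0, representing `ε_{i+1}`) is a β-expansion of `x`. -/
def isExpansion (β x : ℝ) (ε : ℕ → ℕ) : Prop :=
  (∀ i, ε i ≤ 1) ∧ x = ∑' i : ℕ, (ε i : ℝ) / β ^ (i + 1)

/-- A {0,1}-sequence is simply normal if the frequency of zeros tends to 1/2. -/
def simplyNormal (ε : ℕ → ℕ) : Prop :=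
  Filter.Tendsto
    (fun n => (((Finset.range n).filter fun i => ε i = 0).card : ℝ) / n)
    Filter.atTop (nhds (1 / 2))

/-- Tail value of a digit sequence. -/
noncomputable def tailVal (β : ℝ) (ε : ℕ → ℕ) (n : ℕ) : ℝ :=
  ∑' i : ℕ, (ε (n + i) : ℝ) / β ^ (i + 1)

lemma geo_hasSum {β : ℝ} (hβ : 1 < β) :
    HasSum (fun i : ℕ => (1 : ℝ) / β ^ (i + 1)) (1 / (β - 1)) := by
  have h0 : 0 < β := by linarith
  have h1 : β - 1 ≠ 0 := by linarith
  have h := (hasSum_geometric_of_lt_one (inv_nonneg.2 h0.le) (inv_lt_one_of_one_lt₀ hβ)).mul_left β⁻¹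
  have e1 : (fun i : ℕ => (1 : ℝ) / β ^ (i + 1)) = fun i => β⁻¹ * β⁻¹ ^ i := by
    funext i
    rw [pow_succ, inv_pow]
    field_simp
  have e2 : 1 / (β - 1) = β⁻¹ * (1 - β⁻¹)⁻¹ := by
    have : 1 - β⁻¹ = (β - 1) / β := by field_simp
    rw [this]
    field_simp
  rw [e1, e2]
  exact h

lemma tail_summable {β : ℝ} (hβ : 1 < β) {ε : ℕ → ℕ} (hε : ∀ i, ε i ≤ 1) (n : ℕ) :
    Summable (fun i : ℕ => (ε (n + i) : ℝ) / β ^ (i + 1)) := by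
  have h0 : 0 < β := by linarith
  refine Summable.of_nonneg_of_le (fun i => by positivity) (fun i => ?_) (geo_hasSum hβ).summable
  have : (ε (n + i) : ℝ) ≤ 1 := by exact_mod_cast hε (n + i)
  gcongr

lemma tail_nonneg {β : ℝ} (hβ : 1 < β) (ε : ℕ → ℕ) (n : ℕ) : 0 ≤ tailVal β ε n := by
  have h0 : 0 < β := by linarith
  exact tsum_nonneg (fun i => by positivity)

lemma tail_le {β : ℝ} (hβ : 1 < β) {ε : ℕ → ℕ} (hε : ∀ i, ε i ≤ 1) (n : ℕ) :
    tailVal β ε n ≤ 1 / (β - 1) := by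
  have h0 : 0 < β := by linarith
  rw [← (geo_hasSum hβ).tsum_eq]
  refine (tail_summable hβ hε n).tsum_le_tsum (fun i => ?_) (geo_hasSum hβ).summable
  have : (ε (n + i) : ℝ) ≤ 1 := by exact_mod_cast hε (n + i)
  gcongr

lemma tail_rec {β : ℝ} (hβ : 1 < β) {ε : ℕ → ℕ} (hε : ∀ i, ε i ≤ 1) (n : ℕ) :
    β * tailVal β ε n = ε n + tailVal β ε (n + 1) := by
  have h0 : 0 < β := by linarith
  unfold tailVal
  rw [(tail_summable hβ hε n).tsum_eq_zero_add, mul_add, ← tsum_mul_left]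
  congr 1
  · simp; field_simp
  · congr 1
    funext i
    rw [show n + (i + 1) = n + 1 + i by ring, pow_succ β (i + 1)]
    field_simp

/-- Zeros of the digit sequence are at odd residues modulo `2k+1`. -/
def dig (k n : ℕ) : ℕ := if n % (2 * k + 1) % 2 = 0 then 1 else 0

lemma step_cases (k n : ℕ) :
    (n % (2 * k + 1) < 2 * k ∧ (n + 1) % (2 * k + 1) = n % (2 * k + 1) + 1 ∧
      (n + 1) / (2 * k + 1) = n / (2 * k + 1)) ∨
    (n % (2 * k + 1) = 2 * k ∧ (n + 1) % (2 * k + 1) = 0 ∧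
      (n + 1) / (2 * k + 1) = n / (2 * k + 1) + 1) := by
  have hp : 0 < 2 * k + 1 := by omega
  have hlt := Nat.mod_lt n hp
  have hdm := Nat.div_add_mod n (2 * k + 1)
  by_cases h : n % (2 * k + 1) < 2 * k
  · left
    have := (Nat.div_mod_unique (a := n + 1) (c := n % (2 * k + 1) + 1)
      (d := n / (2 * k + 1)) hp).2 ⟨by omega, by omega⟩
    exact ⟨h, this.2, this.1⟩
  · right
    have h2 : n % (2 * k + 1) = 2 * k := by omega
    have := (Nat.div_mod_unique (a := n + 1) (c := 0)
      (d := n / (2 * k + 1) + 1) hp).2 ⟨by rw [mul_add]; omega, hp⟩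
    exact ⟨h2, this.2, this.1⟩

lemma count_dig (k n : ℕ) :
    ((Finset.range n).filter fun i => dig k i = 0).card
      = n / (2 * k + 1) * k + n % (2 * k + 1) / 2 := by
  induction n with
  | zero => simp
  | succ n ih =>
    rw [Finset.range_add_one, Finset.filter_insert]
    have hd : dig k n = 0 ↔ n % (2 * k + 1) % 2 = 1 := by
      unfold dig
      by_cases h : n % (2 * k + 1) % 2 = 0
      · simp [h]
      · simp only [if_neg h, true_iff]; omega
    rcases step_cases k n with ⟨h1, h2, h3⟩ | ⟨h1, h2, h3⟩
    · rw [h2, h3]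
      split_ifs with h
      · rw [Finset.card_insert_of_notMem (by simp), ih]
        rw [hd] at h
        omega
      · rw [ih]
        rw [hd] at h
        omega
    · rw [h2, h3]
      rw [if_neg (by rw [hd]; omega), ih, h1, add_mul]
      omega

lemma dig_not_normal (k : ℕ) : ¬ simplyNormal (dig k) := by
  intro h
  unfold simplyNormal at h
  have hs : Filter.Tendsto (fun m : ℕ => (m + 1) * (2 * k + 1)) Filter.atTop Filter.atTop := by
    refine Filter.tendsto_atTop_mono (fun m => ?_) Filter.tendsto_id
    simp only [id]
    nlinarith
  have h2 := h.comp hs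
  have h3 : ((fun n : ℕ => (((Finset.range n).filter fun i => dig k i = 0).card : ℝ) / n) ∘
      (fun m : ℕ => (m + 1) * (2 * k + 1))) = fun _ => (k : ℝ) / (2 * k + 1) := by
    funext m
    simp only [Function.comp]
    rw [count_dig, Nat.mul_div_cancel _ (by omega), Nat.mul_mod_left]
    push_cast
    have : (m : ℝ) + 1 ≠ 0 := by positivity
    have : (2 * k : ℝ) + 1 ≠ 0 := by positivity
    field_simp
    simp
  rw [h3] at h2
  have h4 := tendsto_nhds_unique h2 tendsto_const_nhds
  have : (2 * k : ℝ) + 1 ≠ 0 := by positivity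
  field_simp at h4
  linarith

/-- Criterion: a bounded potential `V` obeying the digit recursion gives a unique expansion. -/
lemma univoque_of {β : ℝ} (hβ : 1 < β) {ε : ℕ → ℕ} (hε : ∀ i, ε i ≤ 1) (V : ℕ → ℝ)
    (hV0 : ∀ n, 0 ≤ V n) (hV1 : ∀ n, V n ≤ 1)
    (hrec : ∀ n, β * V n = ε n + V (n + 1))
    (hz : ∀ n, ε n = 0 → V (n + 1) < 1)
    (ho : ∀ n, ε n = 1 → 1 / (β - 1) - 1 < V (n + 1)) :
    isExpansion β (V 0) ε ∧ ∀ ε' : ℕ → ℕ, isExpansion β (V 0) ε' → ε' = ε := by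
  constructor
  · refine ⟨hε, ?_⟩
    have key : V 0 = tailVal β ε 0 := by
      have hp : ∀ n, V n - tailVal β ε n = β ^ n * (V 0 - tailVal β ε 0) := by
        intro n
        induction n with
        | zero => simp
        | succ n ih =>
          have h1 := hrec n
          have h2 := tail_rec hβ hε n
          rw [pow_succ]
          linear_combination h2 - h1 + β * ih
      by_contra hne
      have hpos : 0 < |V 0 - tailVal β ε 0| := abs_pos.2 (sub_ne_zero.2 hne)
      obtain ⟨n, hn⟩ := pow_unbounded_of_one_lt
        ((1 + 1 / (β - 1)) / |V 0 - tailVal β ε 0|) hβ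
      rw [div_lt_iff₀ hpos] at hn
      have h3 : |V n - tailVal β ε n| = β ^ n * |V 0 - tailVal β ε 0| := by
        rw [hp n, abs_mul, abs_of_pos (by positivity)]
      have h4 : |V n - tailVal β ε n| ≤ 1 + 1 / (β - 1) := by
        have a1 := hV0 n
        have a2 := hV1 n
        have a3 := tail_nonneg hβ ε n
        have a4 := tail_le hβ hε n
        rw [abs_le]
        constructor <;> linarith
      linarith
    simpa [tailVal] using key
  · rintro ε' ⟨hε', hx⟩
    have h0 : tailVal β ε' 0 = V 0 := by rw [hx]; simp [tailVal]
    have hstep : ∀ n, tailVal β ε' n = V n → ε' n = ε n ∧ tailVal β ε' (n + 1) = V (n + 1) := by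
      intro n hn
      have h1 := hrec n
      have h2 := tail_rec hβ hε' n
      rw [hn] at h2
      have a3 := tail_nonneg hβ ε' (n + 1)
      have a4 := tail_le hβ hε' (n + 1)
      have heq : ε' n = ε n := by
        have b1 := hε n
        have b2 := hε' n
        have c1 : ε n = 0 ∨ ε n = 1 := by omega
        have c2 : ε' n = 0 ∨ ε' n = 1 := by omega
        rcases c1 with c1 | c1 <;> rcases c2 with c2 | c2
        · omega
        · have := hz n c1
          rw [c1] at h1; rw [c2] at h2; push_cast at h1 h2
          linarith
        · have := ho n c1
          rw [c1] at h1; rw [c2] at h2; push_cast at h1 h2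
          linarith
        · omega
      refine ⟨heq, ?_⟩
      rw [heq] at h2
      linarith
    have hall : ∀ n, tailVal β ε' n = V n := by
      intro n
      induction n with
      | zero => exact h0
      | succ n ih => exact (hstep n ih).2
    funext n
    exact (hstep n (hall n)).1

theorem exists_univoque_not_simply_normal_above_betaT
    (βT : ℝ) (hβT : βT ∈ Set.Ioo (1 : ℝ) 2)
    (hroot : βT ^ 3 - βT ^ 2 - 2 * βT + 1 = 0)
    (β : ℝ) (hβ : β ∈ Set.Ioc βT 2) :
    ∃ x ∈ Set.Ioo (0 : ℝ) (1 / (β - 1)), ∃ ε : ℕ → ℕ,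
      isExpansion β x ε ∧ (∀ ε' : ℕ → ℕ, isExpansion β x ε' → ε' = ε) ∧
      ¬ simplyNormal ε := by
  obtain ⟨hT1, hT2⟩ := hβT
  obtain ⟨hb1, hb2⟩ := hβ
  have hT : 1.8 < βT := by
    by_contra hcon
    push Not at hcon
    nlinarith [mul_nonneg (sub_nonneg.2 hcon) (by nlinarith : (0:ℝ) ≤ βT ^ 2 + 0.8 * βT - 0.56)]
  have hb : 1.8 < β := by linarith
  have hcub : 0 < β ^ 3 - β ^ 2 - 2 * β + 1 := by
    have : 0 < (β - βT) * (β ^ 2 + β * βT + βT ^ 2 - β - βT - 2) :=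
      mul_pos (by linarith) (by nlinarith)
    nlinarith
  have hβ1 : 1 < β := by linarith
  have hβ0 : 0 < β := by linarith
  have hm : 0 < β - 1 := by linarith
  have hq : 0 < β ^ 2 - 1 := by nlinarith
  have hg : 0 < β ^ 2 - β - 1 := by nlinarith
  obtain ⟨A, hA⟩ : ∃ A, A = β / (β ^ 2 - 1) := ⟨_, rfl⟩
  obtain ⟨B, hB⟩ : ∃ B, B = 1 / (β ^ 2 - 1) := ⟨_, rfl⟩
  have hBpos : 0 < B := by rw [hB]; positivity
  have hAB : β * B = A := by rw [hA, hB]; field_simp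
  have hBA : β * A = 1 + B := by rw [hA, hB]; field_simp; ring
  have hBA2 : B < A := by nlinarith
  have hBlow : 1 / (β - 1) - 1 < B := by
    have e : 1 / (β - 1) = (β + 1) * B := by
      rw [hB]; field_simp; ring
    have e2 : B * (β ^ 2 - 1) = 1 := by rw [hB]; field_simp
    rw [e]
    nlinarith
  -- choice of k
  have hc : 1 < (1 - A) * (β + 1) * β := by
    have e2 : A * (β ^ 2 - 1) = β := by rw [hA]; field_simp
    have e3 : ((1 - A) * (β + 1) * β - 1) * (β - 1) = β ^ 3 - β ^ 2 - 2 * β + 1 := by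
      linear_combination (-β) * e2
    by_contra hcon
    push Not at hcon
    nlinarith
  obtain ⟨k, hk⟩ := pow_unbounded_of_one_lt
    ((1 - A) * (β + 1) / ((1 - A) * (β + 1) * β - 1)) hβ1
  rw [div_lt_iff₀ (by linarith)] at hk
  have hX : (1 - A) * (β + 1) < β ^ (2 * k) * ((1 - A) * (β + 1) * β - 1) := by
    refine hk.trans_le ?_
    have : β ^ k ≤ β ^ (2 * k) := pow_le_pow_right₀ hβ1.le (by omega)
    exact mul_le_mul_of_nonneg_right this (by linarith)
  have hX1 : 1 ≤ β ^ (2 * k) := one_le_pow₀ hβ1.le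
  have hP : 0 < β * β ^ (2 * k) - 1 := by nlinarith
  obtain ⟨d, hd⟩ : ∃ d, d = 1 / ((β + 1) * (β * β ^ (2 * k) - 1)) := ⟨_, rfl⟩
  have hdpos : 0 < d := by rw [hd]; positivity
  have hdeq : d * ((β + 1) * (β * β ^ (2 * k) - 1)) = 1 := by
    rw [hd]; field_simp
  have hmax : A + d * β ^ (2 * k) < 1 := by
    have : d * β ^ (2 * k) < 1 - A := by
      rw [hd, one_div_mul_eq_div, div_lt_iff₀ (by positivity)]
      nlinarith
    linarith
  have hdAB : d * (β * β ^ (2 * k)) = A - B + d := by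
    have e2 : (A - B) * (β + 1) = 1 := by linear_combination hBA - hAB
    have : (β + 1) ≠ 0 := by linarith
    apply mul_right_cancel₀ this
    linear_combination hdeq - e2
  let V : ℕ → ℝ := fun n =>
    (if n % (2 * k + 1) % 2 = 0 then A else B) + d * β ^ (n % (2 * k + 1))
  have hpowle : ∀ n, d * β ^ (n % (2 * k + 1)) ≤ d * β ^ (2 * k) := by
    intro n
    have : n % (2 * k + 1) < 2 * k + 1 := Nat.mod_lt _ (by omega)
    have := pow_le_pow_right₀ hβ1.le (by omega : n % (2 * k + 1) ≤ 2 * k)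
    exact mul_le_mul_of_nonneg_left this hdpos.le
  have hpowpos : ∀ n, 0 < d * β ^ (n % (2 * k + 1)) := fun n => by positivity
  have hVB : ∀ n, B < V n := by
    intro n
    have := hpowpos n
    simp only [V]
    split_ifs <;> linarith
  have hV1 : ∀ n, V n < 1 := by
    intro n
    have := hpowle n
    simp only [V]
    split_ifs <;> linarith
  have hdig : ∀ i, dig k i ≤ 1 := by
    intro i; unfold dig; split_ifs <;> omega
  have hrec : ∀ n, β * V n = dig k n + V (n + 1) := by
    intro n
    simp only [V, dig]
    rcases step_cases k n with ⟨h1, h2, -⟩ | ⟨h1, h2, -⟩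
    · rw [h2, pow_succ]
      by_cases h : n % (2 * k + 1) % 2 = 0
      · rw [if_pos h, if_pos h, if_neg (by omega)]
        push_cast
        linear_combination hBA
      · rw [if_neg h, if_neg h, if_pos (by omega)]
        push_cast
        linear_combination hAB
    · rw [h2, h1, if_pos (by omega), if_pos (by omega), if_pos (by omega)]
      push_cast
      linear_combination hBA + hdAB
  obtain ⟨he, hu⟩ := univoque_of hβ1 hdig V (fun n => (hBpos.trans (hVB n)).le)
    (fun n => (hV1 n).le) hrec (fun n _ => hV1 (n + 1)) (fun n _ => hBlow.trans (hVB (n + 1)))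
  refine ⟨V 0, ⟨hBpos.trans (hVB 0), (hV1 0).trans_le ?_⟩, dig k, he, hu, dig_not_normal k⟩
  rw [le_div_iff₀ hm]
  linarith
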